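/- arXiv:2204.06257 — 2 statements merged into one kernel-verified Lean document; each statement's English description precedes it below -/
import Mathlib

section
/- Let δ ∈ (0,1), A > 0, 0 < B, and assume A·B^{δ} < 1, so that β_max = A^{−1/δ} − B > 0. Define F(β) = (1 − A(β + B)^{δ})·log₂(1 + β) on [0, β_max]. Then F′(0) > 0, F′(β_max) < 0, and there exists a unique β* ∈ (0, β_max) with F′(β*) = 0; moreover F is strictly increasing on [0, β*] and strictly decreasing on [β*, β_max], so β* is the unique maximizer of F on [0, β_max]. -/
open Real Set

/-- The derivative of `(1 - A (x + B) ^ δ) * logb 2 (1 + x)`, in factored form. -/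
lemma hasDerivAt_one_sub_rpow_mul_logb (δ A B : ℝ) (hB : 0 < B) {x : ℝ} (hx : 0 ≤ x) :
    HasDerivAt (fun x => (1 - A * (x + B) ^ δ) * Real.logb 2 (1 + x))
      ((1 - A * (x + B) ^ δ - A * δ * ((x + B) ^ (δ - 1) * ((1 + x) * Real.log (1 + x))))
        / ((1 + x) * Real.log 2)) x := by
  have hxB : x + B ≠ 0 := by positivity
  have hx1 : 1 + x ≠ 0 := by positivity
  have hlog2 : Real.log 2 ≠ 0 := (Real.log_pos one_lt_two).ne'
  have hpow := ((hasDerivAt_id x).add_const B).rpow_const (p := δ) (Or.inl hxB)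
  have hlog := (((hasDerivAt_id x).const_add 1).log hx1).div_const (Real.log 2)
  refine (((hpow.const_mul A).const_sub 1).mul hlog).congr_deriv ?_
  simp only [id]
  field_simp
  ring

/-- The derivative of the factor which determines the sign of the derivative of
`(1 - A (x + B) ^ δ) * logb 2 (1 + x)`. -/
lemma hasDerivAt_one_sub_rpow_sub_rpow_mul_log (δ A B : ℝ) (hB : 0 < B) {x : ℝ} (hx : 0 ≤ x) :
    HasDerivAt (fun x => 1 - A * (x + B) ^ δ
        - A * δ * ((x + B) ^ (δ - 1) * ((1 + x) * Real.log (1 + x))))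
      (-(A * δ * (x + B) ^ (δ - 1 - 1) *
        ((x + B) * (Real.log (1 + x) + 2) - (1 - δ) * ((1 + x) * Real.log (1 + x))))) x := by
  have hxB : x + B ≠ 0 := by positivity
  have hx1 : 1 + x ≠ 0 := by positivity
  have hbase := (hasDerivAt_id x).add_const B
  have hone := (hasDerivAt_id x).const_add 1
  have hpow := hbase.rpow_const (p := δ) (Or.inl hxB)
  have hpow' := hbase.rpow_const (p := δ - 1) (Or.inl hxB)
  have hlog := hone.mul (hone.log hx1)
  refine (((hpow.const_mul A).const_sub 1).sub
    ((hpow'.mul hlog).const_mul (A * δ))).congr_deriv ?_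
  have hsplit : (x + B) ^ (δ - 1) = (x + B) ^ (δ - 1 - 1) * (x + B) := by
    rw [Real.rpow_sub_one hxB (δ - 1), div_mul_cancel₀ _ hxB]
  simp only [id, Pi.mul_apply, hsplit]
  field_simp
  ring

lemma strictAntiOn_one_sub_rpow_sub_rpow_mul_log {δ A B : ℝ} (hδ : δ ∈ Set.Ioo (0 : ℝ) 1)
    (hA : 0 < A) (hB : 0 < B) :
    StrictAntiOn (fun x => 1 - A * (x + B) ^ δ
      - A * δ * ((x + B) ^ (δ - 1) * ((1 + x) * Real.log (1 + x)))) (Set.Ici 0) := by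
  refine strictAntiOn_of_deriv_neg (convex_Ici 0) (fun x hx =>
    (hasDerivAt_one_sub_rpow_sub_rpow_mul_log δ A B hB hx).continuousAt.continuousWithinAt) ?_
  intro x hx
  rw [interior_Ici, Set.mem_Ioi] at hx
  rw [(hasDerivAt_one_sub_rpow_sub_rpow_mul_log δ A B hB hx.le).deriv, neg_lt_zero]
  have hlog_nonneg : 0 ≤ Real.log (1 + x) := Real.log_nonneg (by linarith)
  have hlog_le : Real.log (1 + x) ≤ x := by
    linarith [Real.log_le_sub_one_of_pos (show 0 < 1 + x by linarith)]
  have hpow : 0 < (x + B) ^ (δ - 1 - 1) := Real.rpow_pos_of_pos (by linarith) _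
  refine mul_pos (mul_pos (mul_pos hA hδ.1) hpow) ?_
  have hδlog : 0 ≤ δ * ((1 + x) * Real.log (1 + x)) :=
    mul_nonneg hδ.1.le (mul_nonneg (by linarith) hlog_nonneg)
  have hBlog : 0 ≤ B * Real.log (1 + x) := mul_nonneg hB.le hlog_nonneg
  nlinarith

/-- Proposition 3 / equation (19): for `F(β) = (1 − A(β+B)^δ)·log₂(1+β)` on
`[0, β_max]` with `β_max = A^{−1/δ} − B > 0`, one has `F′(0) > 0`, `F′(β_max) < 0`,
there is a unique stationary point `β* ∈ (0, β_max)`, `F` is strictly increasing on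
`[0, β*]`, strictly decreasing on `[β*, β_max]`, and `β*` is the unique maximizer. -/
theorem secrecy_throughput_unique_maximizer
    (δ A B : ℝ) (hδ : δ ∈ Set.Ioo (0 : ℝ) 1) (hA : 0 < A) (hB : 0 < B)
    (hAB : A * B ^ δ < 1)
    (βmax : ℝ) (hβmax : βmax = A ^ (-(1 / δ)) - B)
    (F : ℝ → ℝ) (hF : ∀ β, F β = (1 - A * (β + B) ^ δ) * Real.logb 2 (1 + β)) :
    0 < βmax ∧ 0 < deriv F 0 ∧ deriv F βmax < 0 ∧
      ∃ βs ∈ Set.Ioo (0 : ℝ) βmax,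
        deriv F βs = 0
          ∧ (∀ β ∈ Set.Ioo (0 : ℝ) βmax, deriv F β = 0 → β = βs)
          ∧ StrictMonoOn F (Set.Icc 0 βs)
          ∧ StrictAntiOn F (Set.Icc βs βmax)
          ∧ ∀ β ∈ Set.Icc (0 : ℝ) βmax, β ≠ βs → F β < F βs := by
  obtain ⟨hδ0, hδ1⟩ := hδ
  obtain rfl : F = fun β => (1 - A * (β + B) ^ δ) * Real.logb 2 (1 + β) := funext hF
  set F := fun β : ℝ => (1 - A * (β + B) ^ δ) * Real.logb 2 (1 + β)
  set G := fun β : ℝ => 1 - A * (β + B) ^ δ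
    - A * δ * ((β + B) ^ (δ - 1) * ((1 + β) * Real.log (1 + β))) with hG
  have hdF : ∀ β, 0 ≤ β → HasDerivAt F (G β / ((1 + β) * Real.log 2)) β := fun β hβ =>
    hasDerivAt_one_sub_rpow_mul_logb δ A B hB hβ
  have hden : ∀ β : ℝ, 0 ≤ β → 0 < (1 + β) * Real.log 2 := fun β hβ =>
    mul_pos (by linarith) (Real.log_pos one_lt_two)
  have hanti : StrictAntiOn G (Set.Ici 0) :=
    strictAntiOn_one_sub_rpow_sub_rpow_mul_log ⟨hδ0, hδ1⟩ hA hB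
  have hroot : (A ^ (-(1 / δ))) ^ δ = A⁻¹ := by
    rw [← Real.rpow_mul hA.le, neg_mul, one_div_mul_cancel hδ0.ne', Real.rpow_neg_one]
  have hmax : 0 < βmax := by
    have hlt : B ^ δ < (A ^ (-(1 / δ))) ^ δ := by
      rw [hroot, ← one_div, lt_div_iff₀' hA]
      exact hAB
    have := (Real.rpow_lt_rpow_iff hB.le (Real.rpow_nonneg hA.le _) hδ0).1 hlt
    linarith
  have hG0 : 0 < G 0 := by simpa [hG] using hAB
  have hGmax : G βmax < 0 := by
    have hpow : A * (βmax + B) ^ δ = 1 := by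
      rw [hβmax, sub_add_cancel, hroot, mul_inv_cancel₀ hA.ne']
    have hlog : 0 < Real.log (1 + βmax) := Real.log_pos (by linarith)
    have : 0 < A * δ * ((βmax + B) ^ (δ - 1) * ((1 + βmax) * Real.log (1 + βmax))) := by
      positivity
    simp only [hG, hpow]
    linarith
  have hcont : ContinuousOn G (Set.Icc 0 βmax) := fun β hβ =>
    (hasDerivAt_one_sub_rpow_sub_rpow_mul_log δ A B hB
      hβ.1).continuousAt.continuousWithinAt
  obtain ⟨βs, hβs, hGs⟩ := intermediate_value_Ioo' hmax.le hcont ⟨hGmax, hG0⟩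
  have hmono : StrictMonoOn F (Set.Icc 0 βs) := by
    refine strictMonoOn_of_deriv_pos (convex_Icc 0 βs)
      (fun β hβ => (hdF β hβ.1).continuousAt.continuousWithinAt) fun β hβ => ?_
    rw [interior_Icc] at hβ
    rw [(hdF β hβ.1.le).deriv]
    exact div_pos (hGs ▸ hanti hβ.1.le hβs.1.le hβ.2) (hden β hβ.1.le)
  have hantiF : StrictAntiOn F (Set.Icc βs βmax) := by
    refine strictAntiOn_of_deriv_neg (convex_Icc βs βmax)
      (fun β hβ => (hdF β (hβs.1.le.trans hβ.1)).continuousAt.continuousWithinAt) fun β hβ => ?_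
    rw [interior_Icc] at hβ
    have hβ0 : 0 ≤ β := hβs.1.le.trans hβ.1.le
    rw [(hdF β hβ0).deriv]
    exact div_neg_of_neg_of_pos (hGs ▸ hanti hβs.1.le hβ0 hβ.1) (hden β hβ0)
  refine ⟨hmax, ?_, ?_, βs, hβs, ?_, fun β hβ hzero => ?_, hmono, hantiF, fun β hβ hne => ?_⟩
  · rw [(hdF 0 le_rfl).deriv]
    exact div_pos hG0 (hden 0 le_rfl)
  · rw [(hdF βmax hmax.le).deriv]
    exact div_neg_of_neg_of_pos hGmax (hden βmax hmax.le)
  · rw [(hdF βs hβs.1.le).deriv, hGs, zero_div]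
  · rw [(hdF β hβ.1.le).deriv, div_eq_zero_iff, or_iff_left (hden β hβ.1.le).ne'] at hzero
    exact hanti.injOn hβ.1.le hβs.1.le (hzero.trans hGs.symm)
  · rcases hne.lt_or_gt with h | h
    · exact hmono ⟨hβ.1, h.le⟩ ⟨hβs.1.le, le_rfl⟩ h
    · exact hantiF ⟨le_rfl, hβs.2.le⟩ ⟨h.le, hβ.2⟩ h
end

section
/- With the setup below and assuming ρ_min < 1: the condition G(ρ_min) < 0 is equivalent to Z < Y·ρ_min^{α/2+1}·(1 − κ(ρ_min))/(1 + Y·ρ_min·κ(ρ_min)); and if G(ρ_min) < 0 then T is strictly decreasing on [ρ_min, 1], so ρ_min is the unique maximizer of T over [ρ_min, 1]. -/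
open Real Set Finset

/-- The log-derivative of `1 + x (1 + y ρ) ^ (-a)`. -/
lemma hasDerivAt_log_one_add_mul_rpow_neg {a x y ρ : ℝ} (hx : 0 ≤ x) (hρ : 0 < 1 + y * ρ) :
    HasDerivAt (fun r => Real.log (1 + x * (1 + y * r) ^ (-a)))
      (-(a * y / (1 + y * ρ)) * (1 - 1 / (1 + x * (1 + y * ρ) ^ (-a)))) ρ := by
  have hlin : HasDerivAt (fun r => 1 + y * r) y ρ := by
    simpa using ((hasDerivAt_id ρ).const_mul y).const_add 1
  have hp : 0 < (1 + y * ρ) ^ (-a) := Real.rpow_pos_of_pos hρ _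
  have hW : 1 + x * (1 + y * ρ) ^ (-a) ≠ 0 := by positivity
  convert (((hlin.rpow_const (p := -a) (Or.inl hρ.ne')).const_mul x).const_add 1).log hW using 1
  rw [Real.rpow_sub_one hρ.ne']
  field_simp
  ring

/-- The log-derivative of `1 + z ρ ^ (-a)`. -/
lemma hasDerivAt_log_one_add_mul_rpow_neg_self {a z ρ : ℝ} (hz : 0 ≤ z) (hρ : 0 < ρ) :
    HasDerivAt (fun r => Real.log (1 + z * r ^ (-a))) (-(a * z / (ρ * (ρ ^ a + z)))) ρ := by
  have hp : 0 < ρ ^ a := Real.rpow_pos_of_pos hρ _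
  have hQ : 1 + z * ρ ^ (-a) ≠ 0 := by
    have := Real.rpow_pos_of_pos hρ (-a)
    positivity
  convert (((Real.hasDerivAt_rpow_const (p := -a) (Or.inl hρ.ne')).const_mul z).const_add 1).log hQ
    using 1
  rw [Real.rpow_sub_one hρ.ne', Real.rpow_neg hρ.le]
  have : ρ ^ a + z ≠ 0 := by positivity
  have : 1 + z * (ρ ^ a)⁻¹ ≠ 0 := by positivity
  field_simp

/-- The derivative of a sum of logarithmic ratios has the sign of
`1 + Yρκ - (Y/Z) ρ ^ (a + 1) (1 - κ)`, where `κ` is the mean of the reciprocals `1 / W_k`. -/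
lemma hasDerivAt_sum_log_div {ι : Type*} [Fintype ι] [Nonempty ι] {a Y Z ρ c : ℝ} {X : ι → ℝ}
    (hX : ∀ k, 0 < X k) (hY : 0 < Y) (hZ : 0 < Z) (hρ : 0 < ρ)
    (hc : c = (Fintype.card ι : ℝ)⁻¹ * ∑ k, 1 / (1 + X k * (1 + Y * ρ) ^ (-a))) :
    HasDerivAt
      (fun r => ∑ k, Real.log ((1 + X k * (1 + Y * r) ^ (-a)) / (1 + Z * r ^ (-a))))
      (a * Fintype.card ι * Z / (ρ * (ρ ^ a + Z) * (1 + Y * ρ)) *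
        (1 + Y * ρ * c - (Y / Z) * ρ ^ (a + 1) * (1 - c))) ρ := by
  have hlin : 0 < 1 + Y * ρ := by positivity
  have hsum : HasDerivAt (fun r => ∑ k, (Real.log (1 + X k * (1 + Y * r) ^ (-a)) -
      Real.log (1 + Z * r ^ (-a))))
      (∑ k, (-(a * Y / (1 + Y * ρ)) * (1 - 1 / (1 + X k * (1 + Y * ρ) ^ (-a))) -
        -(a * Z / (ρ * (ρ ^ a + Z))))) ρ :=
    HasDerivAt.fun_sum fun k _ =>
      (hasDerivAt_log_one_add_mul_rpow_neg (hX k).le hlin).sub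
        (hasDerivAt_log_one_add_mul_rpow_neg_self hZ.le hρ)
  have heq : (fun r => ∑ k, Real.log ((1 + X k * (1 + Y * r) ^ (-a)) / (1 + Z * r ^ (-a))))
      =ᶠ[nhds ρ] fun r => ∑ k, (Real.log (1 + X k * (1 + Y * r) ^ (-a)) -
        Real.log (1 + Z * r ^ (-a))) := by
    filter_upwards [lt_mem_nhds hρ] with r hr
    refine Finset.sum_congr rfl fun k _ => Real.log_div ?_ ?_
    · have := Real.rpow_pos_of_pos (show 0 < 1 + Y * r by positivity) (-a)
      have := hX k
      positivity
    · have := Real.rpow_pos_of_pos hr (-a)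
      positivity
  refine (hsum.congr_of_eventuallyEq heq).congr_deriv ?_
  have hcard : (Fintype.card ι : ℝ) ≠ 0 := by simp
  have hs : ∑ k, 1 / (1 + X k * (1 + Y * ρ) ^ (-a)) = Fintype.card ι * c := by
    rw [hc, mul_inv_cancel_left₀ hcard]
  rw [Finset.sum_sub_distrib, ← Finset.mul_sum, Finset.sum_sub_distrib, hs]
  simp only [Finset.sum_const, Finset.card_univ, nsmul_eq_mul]
  rw [Real.rpow_add_one hρ.ne']
  have hp : 0 < ρ ^ a := Real.rpow_pos_of_pos hρ _
  have : ρ ^ a + Z ≠ 0 := by positivity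
  field_simp
  ring

/-- The sign function written as one minus a mean of products of monotone factors. -/
lemma one_add_sub_eq_one_sub_mean {ι : Type*} [Fintype ι] [Nonempty ι] {a Y Z ρ c : ℝ}
    {X : ι → ℝ} (hX : ∀ k, 0 < X k) (hY : 0 < Y) (hZ : 0 < Z) (hρ : 0 < ρ)
    (hc : c = (Fintype.card ι : ℝ)⁻¹ * ∑ k, 1 / (1 + X k * (1 + Y * ρ) ^ (-a))) :
    1 + Y * ρ * c - (Y / Z) * ρ ^ (a + 1) * (1 - c) =
      1 - (Fintype.card ι : ℝ)⁻¹ * ∑ k, Y * ρ * (X k / Z * (ρ / (1 + Y * ρ)) ^ a - 1) *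
        (1 / (1 + X k * (1 + Y * ρ) ^ (-a))) := by
  have hlin : 0 < 1 + Y * ρ := by positivity
  have hcard : (Fintype.card ι : ℝ) ≠ 0 := by simp
  have hs : ∑ k, 1 / (1 + X k * (1 + Y * ρ) ^ (-a)) = Fintype.card ι * c := by
    rw [hc, mul_inv_cancel_left₀ hcard]
  have hterm : ∀ k, Y * ρ * (X k / Z * (ρ / (1 + Y * ρ)) ^ a - 1) *
      (1 / (1 + X k * (1 + Y * ρ) ^ (-a))) =
      Y / Z * ρ ^ (a + 1) * (1 - 1 / (1 + X k * (1 + Y * ρ) ^ (-a))) -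
        Y * ρ * (1 / (1 + X k * (1 + Y * ρ) ^ (-a))) := by
    intro k
    have hp : 0 < (1 + Y * ρ) ^ a := Real.rpow_pos_of_pos hlin _
    have := hX k
    rw [Real.div_rpow hρ.le hlin.le, Real.rpow_neg hlin.le, Real.rpow_add_one hρ.ne']
    have : (1 + Y * ρ) ^ a + X k ≠ 0 := by positivity
    have : 1 + X k * ((1 + Y * ρ) ^ a)⁻¹ ≠ 0 := by positivity
    field_simp
    ring
  rw [Finset.sum_congr rfl fun k _ => hterm k, Finset.sum_sub_distrib, ← Finset.mul_sum,
    ← Finset.mul_sum, Finset.sum_sub_distrib, hs]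
  simp only [Finset.sum_const, Finset.card_univ, nsmul_eq_mul]
  field_simp
  ring

/-- Past the point where `X / Z * (r / (1 + Y r)) ^ a` reaches `1`, each summand of the mean in
`one_add_sub_eq_one_sub_mean` is monotone. -/
lemma mul_sub_one_mul_inv_mono {a X Y Z r s : ℝ} (ha : 0 ≤ a) (hX : 0 < X) (hY : 0 < Y)
    (hZ : 0 < Z) (hr : 0 < r) (hrs : r ≤ s) (h : 1 ≤ X / Z * (r / (1 + Y * r)) ^ a) :
    Y * r * (X / Z * (r / (1 + Y * r)) ^ a - 1) * (1 / (1 + X * (1 + Y * r) ^ (-a))) ≤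
      Y * s * (X / Z * (s / (1 + Y * s)) ^ a - 1) * (1 / (1 + X * (1 + Y * s) ^ (-a))) := by
  have hs : 0 < s := hr.trans_le hrs
  have hlr : 0 < 1 + Y * r := by positivity
  have hls : 0 < 1 + Y * s := by positivity
  have hps := Real.rpow_pos_of_pos hls (-a)
  have hpr := Real.rpow_pos_of_pos hlr (-a)
  have hdiv : r / (1 + Y * r) ≤ s / (1 + Y * s) := by
    rw [div_le_div_iff₀ hlr hls]
    linarith
  have hpow : (r / (1 + Y * r)) ^ a ≤ (s / (1 + Y * s)) ^ a :=
    Real.rpow_le_rpow (by positivity) hdiv ha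
  have hneg : (1 + Y * s) ^ (-a) ≤ (1 + Y * r) ^ (-a) :=
    Real.rpow_le_rpow_of_nonpos hlr (by gcongr) (by linarith)
  have hratio : X / Z * (r / (1 + Y * r)) ^ a ≤ X / Z * (s / (1 + Y * s)) ^ a := by gcongr
  have hnn : 0 ≤ X / Z * (r / (1 + Y * r)) ^ a - 1 := by linarith
  have hnn' : 0 ≤ X / Z * (s / (1 + Y * s)) ^ a - 1 := by linarith
  gcongr

/-- If `r` is at least the threshold `((X / Z) ^ a⁻¹ - Y)⁻¹` then
`Z r ^ (-a) ≤ X (1 + Y r) ^ (-a)`, in ratio form. -/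
lemma one_le_mul_rpow_of_threshold_le {a X Y Z r : ℝ} (ha : 0 < a) (hX : 0 < X) (hY : 0 < Y)
    (hZ : 0 < Z) (hXZ : Y < (X / Z) ^ a⁻¹) (hr : ((X / Z) ^ a⁻¹ - Y)⁻¹ ≤ r) :
    1 ≤ X / Z * (r / (1 + Y * r)) ^ a := by
  have hd : 0 < (X / Z) ^ a⁻¹ - Y := sub_pos.2 hXZ
  have hr0 : 0 < r := (inv_pos.2 hd).trans_le hr
  have hlin : 0 < 1 + Y * r := by positivity
  have h1 : 1 ≤ (X / Z) ^ a⁻¹ * (r / (1 + Y * r)) := by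
    rw [← mul_div_assoc, le_div_iff₀ hlin]
    have := (inv_le_iff_one_le_mul₀ hd).1 hr
    linarith
  calc (1 : ℝ) ≤ ((X / Z) ^ a⁻¹ * (r / (1 + Y * r))) ^ a := Real.one_le_rpow h1 ha.le
    _ = X / Z * (r / (1 + Y * r)) ^ a := by
      rw [Real.mul_rpow (by positivity) (by positivity),
        Real.rpow_inv_rpow (by positivity) ha.ne']

/-- First case of Proposition 5 (equation (28), first branch): with the setup of the
sub-optimal design and `ρ_min < 1`, the condition `G(ρ_min) < 0` is equivalent to
`Z < Yρ_min^{α/2+1}(1−κ(ρ_min))/(1+Yρ_min κ(ρ_min))`, and if `G(ρ_min) < 0` then the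
sum secrecy throughput `T` is strictly decreasing on `[ρ_min, 1]`, so `ρ_min` is the
unique maximizer of `T` over `[ρ_min, 1]`. -/
theorem optimal_jamming_first_case
    (α δ : ℝ) (hα : 2 < α) (hδ : δ = 2 / α) (K : ℕ) (hK : 1 ≤ K)
    (X : Fin K → ℝ) (Y Z : ℝ) (hX : ∀ k, 0 < X k) (hY : 0 < Y) (hZ : 0 < Z)
    (hXZ : ∀ k, Y < (X k / Z) ^ δ)
    (ρmin : ℝ)
    (hρmin : IsGreatest (Set.range fun k => ((X k / Z) ^ δ - Y)⁻¹) ρmin)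
    (hρmin1 : ρmin < 1)
    (T : ℝ → ℝ)
    (hT : ∀ ρ, T ρ = ∑ k, Real.log
        ((1 + X k * (1 + Y * ρ) ^ (-(α / 2))) / (1 + Z * ρ ^ (-(α / 2)))))
    (κ : ℝ → ℝ)
    (hκ : ∀ ρ, κ ρ = ((K : ℝ))⁻¹ * ∑ k, 1 / (1 + X k * (1 + Y * ρ) ^ (-(α / 2))))
    (G : ℝ → ℝ)
    (hG : ∀ ρ, G ρ = 1 + Y * ρ * κ ρ - (Y / Z) * ρ ^ (α / 2 + 1) * (1 - κ ρ)) :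
    (G ρmin < 0 ↔
        Z < Y * ρmin ^ (α / 2 + 1) * (1 - κ ρmin) / (1 + Y * ρmin * κ ρmin))
      ∧ (G ρmin < 0 →
          StrictAntiOn T (Set.Icc ρmin 1)
            ∧ ∀ ρ ∈ Set.Icc ρmin 1, ρ ≠ ρmin → T ρ < T ρmin) := by
  have : Nonempty (Fin K) := ⟨⟨0, hK⟩⟩
  have ha : 0 < α / 2 := by linarith
  have hδa : δ = (α / 2)⁻¹ := by rw [hδ, inv_div]
  subst hδa
  obtain ⟨⟨k₀, hk₀⟩, hub⟩ := hρmin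
  have hpos : 0 < ρmin := hk₀ ▸ inv_pos.2 (sub_pos.2 (hXZ k₀))
  have hthr : ∀ k, ((X k / Z) ^ (α / 2)⁻¹ - Y)⁻¹ ≤ ρmin := fun k => hub ⟨k, rfl⟩
  have hκ' : ∀ ρ, κ ρ = (Fintype.card (Fin K) : ℝ)⁻¹ *
      ∑ k, 1 / (1 + X k * (1 + Y * ρ) ^ (-(α / 2))) := by simpa using hκ
  have hGanti : ∀ ρ, ρmin ≤ ρ → G ρ ≤ G ρmin := by
    intro ρ hρ
    rw [hG, hG, one_add_sub_eq_one_sub_mean hX hY hZ (hpos.trans_le hρ) (hκ' ρ),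
      one_add_sub_eq_one_sub_mean hX hY hZ hpos (hκ' ρmin)]
    refine sub_le_sub_left (mul_le_mul_of_nonneg_left (Finset.sum_le_sum fun k _ => ?_)
      (by positivity)) 1
    exact mul_sub_one_mul_inv_mono ha.le (hX k) hY hZ hpos hρ
      (one_le_mul_rpow_of_threshold_le ha (hX k) hY hZ (hXZ k) (hthr k))
  have hderiv : ∀ ρ, 0 < ρ → HasDerivAt T
      (α / 2 * Fintype.card (Fin K) * Z / (ρ * (ρ ^ (α / 2) + Z) * (1 + Y * ρ)) * G ρ) ρ := by
    intro ρ hρ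
    rw [hG, funext hT]
    exact hasDerivAt_sum_log_div hX hY hZ hρ (hκ' ρ)
  constructor
  · have hκ0 : 0 ≤ κ ρmin := by
      rw [hκ]
      have hp := Real.rpow_pos_of_pos (show 0 < 1 + Y * ρmin by positivity) (-(α / 2))
      refine mul_nonneg (by positivity) (Finset.sum_nonneg fun k _ => ?_)
      have := hX k
      positivity
    have hden : 0 < 1 + Y * ρmin * κ ρmin := by positivity
    have hZG : Z * G ρmin = Z * (1 + Y * ρmin * κ ρmin) -
        Y * ρmin ^ (α / 2 + 1) * (1 - κ ρmin) := by
      rw [hG]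
      field_simp
    rw [lt_div_iff₀ hden, ← sub_neg (a := Z * _), ← hZG, ← smul_eq_mul, smul_neg_iff_of_pos_left hZ]
  · intro hneg
    have hanti : StrictAntiOn T (Set.Icc ρmin 1) := by
      refine strictAntiOn_of_hasDerivWithinAt_neg (convex_Icc _ _)
        (fun ρ hρ => (hderiv ρ (hpos.trans_le hρ.1)).continuousAt.continuousWithinAt)
        (fun ρ hρ => (hderiv ρ (hpos.trans_le (interior_subset hρ).1)).hasDerivWithinAt)
        fun ρ hρ => ?_
      have hρ0 : ρmin ≤ ρ := (interior_subset hρ).1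
      have hρpos : 0 < ρ := hpos.trans_le hρ0
      have hp : 0 < ρ ^ (α / 2) := Real.rpow_pos_of_pos hρpos _
      have hcard : (0 : ℝ) < Fintype.card (Fin K) := by exact_mod_cast Fintype.card_pos
      exact mul_neg_of_pos_of_neg (by positivity) ((hGanti ρ hρ0).trans_lt hneg)
    exact ⟨hanti, fun ρ hρ hne =>
      hanti (Set.left_mem_Icc.2 hρmin1.le) hρ (lt_of_le_of_ne hρ.1 hne.symm)⟩
end
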